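/- Let n ≥ 2 and let a(t,x) satisfy Assumption (A). Let t₀ > 0, a ≥ 1, let K be a relatively compact neighborhood of x₀ ∈ ℝⁿ and Γ a conic neighborhood of ξ₀ ∈ ℝⁿ\{0}. Then there exist c > 0 and λ₀ ≥ 1 such that the backward endpoint of the Hamiltonian trajectory satisfies |x(0; t₀, x, λξ)| ≥ c λ for all λ ≥ λ₀, x ∈ K and ξ ∈ Γ_a. In particular |x(0;t₀,x,λξ)| ≥ λ t₀ |ξ| − |x| − (3t₀/(4a)) λ for all sufficiently large λ. -/

import Mathlib

open MeasureTheory Complex Filter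

noncomputable section

abbrev V (n : ℕ) := EuclideanSpace ℝ (Fin n)

/-- Japanese bracket power `⟨x⟩^s`. -/
def jap {n : ℕ} (x : V n) (s : ℝ) : ℝ := (1 + ‖x‖ ^ 2) ^ (s / 2)

/-- Assumption (A) on the magnetic vector potential. -/
def AssumptionA {n : ℕ} (a : ℝ → V n → V n) (ρ : ℝ) : Prop :=
  ContDiff ℝ (⊤ : ℕ∞) (fun p : ℝ × V n => a p.1 p.2) ∧
  ∀ k : ℕ, ∃ C : ℝ, 0 < C ∧ ∀ t : ℝ, ∀ x : V n,
    ‖iteratedFDeriv ℝ k (a t) x‖ ≤ C * jap x (ρ - k)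

/-- The Hamiltonian flow of `h(t,x,ξ) = |ξ - a(t,x)|²/2` with data `(x, ξ)` at time `t₀`. -/
def IsHamFlow {n : ℕ} (a : ℝ → V n → V n) (t₀ : ℝ) (x ξ : V n) (X Ξ : ℝ → V n) : Prop :=
  X t₀ = x ∧ Ξ t₀ = ξ ∧ ∀ s : ℝ,
    HasDerivAt X (Ξ s - a s (X s)) s ∧
    HasDerivAt Ξ (ContinuousLinearMap.adjoint (fderiv ℝ (a s) (X s)) (Ξ s - a s (X s))) s

/-- Conic neighborhood of `ξ₀`. -/
def IsConicNbhd {n : ℕ} (Γ : Set (V n)) (ξ₀ : V n) : Prop :=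
  IsOpen Γ ∧ ξ₀ ∈ Γ ∧ ∀ ξ ∈ Γ, ∀ c : ℝ, 0 < c → c • ξ ∈ Γ

def msize {n : ℕ} (α : Fin n → ℕ) : ℕ := ∑ j, α j

open Topology Set in
theorem exists_mul_jap_le {n : ℕ} {σ C η : ℝ} (hσ : σ < 0) (hη : 0 < η) :
    ∃ M : ℝ, ∀ x : V n, M ≤ ‖x‖ → C * jap x σ ≤ η := by
  have h1 : Tendsto (fun r : ℝ => C * (1 + r ^ 2) ^ (σ / 2)) atTop (𝓝 0) := by
    have h2 : Tendsto (fun r : ℝ => 1 + r ^ 2) atTop atTop :=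
      tendsto_atTop_add_const_left _ _ (tendsto_pow_atTop two_ne_zero)
    have h3 := (tendsto_rpow_neg_atTop (y := -(σ / 2)) (by linarith)).comp h2
    simpa [Function.comp_def] using h3.const_mul C
  obtain ⟨M, hM⟩ := eventually_atTop.1 (h1.eventually (gt_mem_nhds hη))
  exact ⟨M, fun x hx => (hM ‖x‖ hx).le⟩

theorem jap_le_one {n : ℕ} {σ : ℝ} (hσ : σ < 0) (x : V n) : jap x σ ≤ 1 :=
  Real.rpow_le_one_of_one_le_of_nonpos (by nlinarith [sq_nonneg ‖x‖]) (by linarith)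

theorem jap_nonneg {n : ℕ} (σ : ℝ) (x : V n) : 0 ≤ jap x σ :=
  Real.rpow_nonneg (by positivity) _

theorem jap_le_mul {n : ℕ} (ρ : ℝ) (x : V n) : jap x ρ ≤ jap x (ρ - 1) * (1 + ‖x‖) := by
  have hb : (0 : ℝ) < 1 + ‖x‖ ^ 2 := by positivity
  have h1 : jap x ρ = jap x (ρ - 1) * (1 + ‖x‖ ^ 2) ^ (1 / 2 : ℝ) := by
    rw [jap, jap, ← Real.rpow_add hb]
    congr 1
    ring
  rw [h1, ← Real.sqrt_eq_rpow]
  gcongr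
  · exact jap_nonneg _ _
  · exact Real.sqrt_le_iff.2 ⟨by positivity, by nlinarith [norm_nonneg x]⟩

/-- Functions bounded by a power of the Japanese bracket below `1` grow sublinearly. -/
theorem exists_mul_jap_le_add {n : ℕ} {ρ C η : ℝ} (hρ : ρ < 1) (hC : 0 < C) (hη : 0 < η) :
    ∃ B : ℝ, 0 < B ∧ ∀ x : V n, C * jap x ρ ≤ B + η * ‖x‖ := by
  obtain ⟨M, hM⟩ := exists_mul_jap_le (n := n) (σ := ρ - 1) (C := C) (by linarith) hη
  refine ⟨η + C * (1 + |M|), by positivity, fun x => ?_⟩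
  have h1 : C * jap x ρ ≤ C * jap x (ρ - 1) * (1 + ‖x‖) := by
    rw [mul_assoc]
    exact mul_le_mul_of_nonneg_left (jap_le_mul ρ x) hC.le
  have hx := norm_nonneg x
  have hCM : 0 ≤ C * (1 + |M|) := by positivity
  rcases le_or_gt M ‖x‖ with h | h
  · have := mul_le_mul_of_nonneg_right (hM x h) (by positivity : 0 ≤ 1 + ‖x‖)
    linarith
  · have h2 : C * jap x (ρ - 1) ≤ C :=
      mul_le_of_le_one_right hC.le (jap_le_one (by linarith) x)
    have h3 : C * jap x (ρ - 1) * (1 + ‖x‖) ≤ C * (1 + |M|) :=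
      mul_le_mul h2 (by linarith [le_abs_self M]) (by positivity) hC.le
    have : 0 ≤ η * ‖x‖ := by positivity
    linarith

/-- Grönwall bound for a pair of curves whose velocities grow at most linearly. -/
theorem norm_pair_le_of_linear_growth {E : Type*} [NormedAddCommGroup E] [NormedSpace ℝ E]
    {Y P Y' P' : ℝ → E} {D B δ T : ℝ} (hD : 0 ≤ D) (hB : 0 ≤ B) (hδ : 0 ≤ δ)
    (hY : ∀ s, HasDerivAt Y (Y' s) s) (hP : ∀ s, HasDerivAt P (P' s) s)
    (hY' : ∀ s, ‖Y' s‖ ≤ ‖P s‖ + B + ‖Y s‖)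
    (hP' : ∀ s, ‖P' s‖ ≤ D * (‖P s‖ + B + ‖Y s‖))
    (hY0 : ‖Y 0‖ ≤ δ) (hP0 : ‖P 0‖ ≤ δ) {s : ℝ} (hs : s ∈ Set.Icc 0 T) :
    ‖Y s‖ ≤ (δ + B) * Real.exp (2 * (1 + D) * T) ∧
      ‖P s‖ ≤ (δ + B) * Real.exp (2 * (1 + D) * T) := by
  have hK : 2 * (1 + D) ≠ 0 := by positivity
  have hZ : ∀ s, HasDerivAt (fun s => (Y s, P s)) (Y' s, P' s) s := fun s => (hY s).prodMk (hP s)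
  have h := norm_le_gronwallBound_of_norm_deriv_right_le (f := fun s => (Y s, P s))
    (f' := fun s => (Y' s, P' s)) (δ := δ) (K := 2 * (1 + D)) (ε := (1 + D) * B) (a := 0) (b := T)
    (fun s _ => (hZ s).continuousAt.continuousWithinAt) (fun s _ => (hZ s).hasDerivWithinAt)
    (by simpa [Prod.norm_def] using ⟨hY0, hP0⟩)
    (by
      intro s _
      have h1 : ‖Y s‖ ≤ ‖(Y s, P s)‖ := norm_fst_le (Y s, P s)
      have h2 : ‖P s‖ ≤ ‖(Y s, P s)‖ := norm_snd_le (Y s, P s)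
      have h3 : ‖P s‖ + B + ‖Y s‖ ≤ 2 * ‖(Y s, P s)‖ + B := by linarith
      have h4 := norm_nonneg (P s)
      have h5 := norm_nonneg (Y s)
      have h6 : (1 + D) * (‖P s‖ + B + ‖Y s‖) ≤ (1 + D) * (2 * ‖(Y s, P s)‖ + B) := by gcongr
      have h7 : 0 ≤ D * (‖P s‖ + B + ‖Y s‖) := by positivity
      have h8 : ‖(Y' s, P' s)‖ ≤ (1 + D) * (‖P s‖ + B + ‖Y s‖) := by
        rw [Prod.norm_def]
        exact max_le (by linarith [hY' s]) (by linarith [hP' s])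
      linarith)
    s hs
  have h2 : gronwallBound δ (2 * (1 + D)) ((1 + D) * B) (s - 0)
      ≤ (δ + B) * Real.exp (2 * (1 + D) * T) := by
    rw [gronwallBound_of_K_ne_0 hK, sub_zero]
    have he : Real.exp (2 * (1 + D) * s) ≤ Real.exp (2 * (1 + D) * T) := by
      gcongr
      exact hs.2
    have hq : (1 + D) * B / (2 * (1 + D)) = B / 2 := by
      field_simp
    rw [hq]
    have := Real.exp_pos (2 * (1 + D) * s)
    nlinarith
  exact ⟨(norm_fst_le (Y s, P s)).trans (h.trans h2), (norm_snd_le (Y s, P s)).trans (h.trans h2)⟩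

theorem norm_sub_add_smul_le_of_deriv_add_le {E : Type*} [NormedAddCommGroup E] [NormedSpace ℝ E]
    {Y Y' : ℝ → E} {v : E} {C s : ℝ} (hs : 0 ≤ s) (hY : ∀ r, HasDerivAt Y (Y' r) r)
    (hC : ∀ r ∈ Set.Ico 0 s, ‖Y' r + v‖ ≤ C) : ‖Y s - Y 0 + s • v‖ ≤ C * s := by
  have hf : ∀ r, HasDerivAt (fun r => Y r + r • v) (Y' r + v) r := fun r => by
    simpa using (hY r).fun_add ((hasDerivAt_id' r).smul_const v)
  have h := norm_image_sub_le_of_norm_deriv_le_segment' (fun q _ => (hf q).hasDerivWithinAt) hC s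
    ⟨hs, le_rfl⟩
  simpa [add_sub_right_comm] using h

/-- A curve `Y` moving with velocity close to `-v`, up to an error `g` whose derivative is small
while `Y` is far from the origin, keeps `g` small. -/
theorem norm_le_of_deriv_small_far {E : Type*} [NormedAddCommGroup E] [NormedSpace ℝ E]
    {Y g Y' g' : ℝ → E} {v : E} {T R M δ D η l κ : ℝ} (hη : 0 ≤ η) (hD : 0 ≤ D)
    (hl : 0 ≤ l)
    (hY : ∀ s, HasDerivAt Y (Y' s) s) (hg : ∀ s, HasDerivAt g (g' s) s)
    (hg0 : g 0 = 0) (hY0 : ‖Y 0‖ ≤ R)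
    (hY' : ∀ s ∈ Set.Icc 0 T, ‖Y' s + v‖ ≤ ‖g s‖ + δ)
    (hgD : ∀ s ∈ Set.Icc 0 T, ‖g' s‖ ≤ D)
    (hgη : ∀ s ∈ Set.Icc 0 T, M ≤ ‖Y s‖ → ‖g' s‖ ≤ η)
    (hκ : 0 ≤ κ) (hv : κ + 2 * δ ≤ ‖v‖) (hM : M + R ≤ κ * l) (hsmall : D * l + η * T < δ) :
    ∀ s ∈ Set.Icc 0 T, ‖g s‖ ≤ δ := by
  by_contra! hcon
  obtain ⟨s₁, hs₁, hgs₁⟩ := hcon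
  have hgc : Continuous g := continuous_iff_continuousAt.2 fun s => (hg s).continuousAt
  have hcomp : IsCompact (Set.Icc 0 T ∩ {s | δ ≤ ‖g s‖}) :=
    isCompact_Icc.inter_right (isClosed_le continuous_const hgc.norm)
  obtain ⟨s, ⟨hs, hgs⟩, hmin⟩ := hcomp.exists_isLeast ⟨s₁, hs₁, hgs₁.le⟩
  have hsub : ∀ r ∈ Set.Ico 0 s, r ∈ Set.Icc 0 T := fun r hr => ⟨hr.1, hr.2.le.trans hs.2⟩
  have hlt : ∀ r ∈ Set.Ico 0 s, ‖g r‖ ≤ δ := by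
    intro r hr
    by_contra! h
    exact absurd (hmin ⟨hsub r hr, h.le⟩) (not_le.2 hr.2)
  have hfar : ∀ r ∈ Set.Ico 0 s, l ≤ r → M ≤ ‖Y r‖ := by
    intro r hr hlr
    have h1 : ‖Y r - Y 0 + r • v‖ ≤ 2 * δ * r :=
      norm_sub_add_smul_le_of_deriv_add_le hr.1 hY fun q hq => by
        have hq' : q ∈ Set.Ico 0 s := ⟨hq.1, hq.2.trans hr.2⟩
        linarith [hY' q (hsub q hq'), hlt q hq']
    have h2 : r * ‖v‖ ≤ ‖Y r - Y 0 + r • v‖ + ‖Y r‖ + ‖Y 0‖ := by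
      have h3 : r • v = (Y r - Y 0 + r • v) - Y r + Y 0 := by abel
      have h4 : ‖r • v‖ = r * ‖v‖ := by rw [norm_smul, Real.norm_of_nonneg hr.1]
      rw [← h4]
      conv_lhs => rw [h3]
      exact (norm_add_le _ _).trans (by gcongr; exact norm_sub_le _ _)
    have h5 : κ * l ≤ κ * r := by gcongr
    have h6 : r * (κ + 2 * δ) ≤ r * ‖v‖ := mul_le_mul_of_nonneg_left hv hr.1
    nlinarith
  have hnear : ∀ r ∈ Set.Icc 0 s, ‖g r‖ ≤ D * r := by
    intro r hr
    have h1 := norm_image_sub_le_of_norm_deriv_le_segment' (f := g) (f' := g') (a := 0) (b := s)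
      (fun q _ => (hg q).hasDerivWithinAt) (fun q hq => hgD q (hsub q hq)) r hr
    simpa [hg0] using h1
  have hηT : 0 ≤ η * T := mul_nonneg hη (hs.1.trans hs.2)
  rw [Set.mem_ofPred_eq] at hgs
  rcases le_total s l with hsl | hls
  · have h1 := hnear s ⟨hs.1, le_rfl⟩
    have h2 : D * s ≤ D * l := by gcongr
    linarith
  · have h1 := hnear l ⟨hl, hls⟩
    have h2 := norm_image_sub_le_of_norm_deriv_le_segment' (f := g) (f' := g') (a := l) (b := s)
      (C := η) (fun q _ => (hg q).hasDerivWithinAt)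
      (fun q hq => by
        have hq' : q ∈ Set.Ico 0 s := ⟨hl.trans hq.1, hq.2⟩
        exact hgη q (hsub q hq') (hfar q hq' hq.1)) s ⟨hls, le_rfl⟩
    have h3 : η * (s - l) ≤ η * T := by
      gcongr
      linarith [hs.2]
    have h4 := norm_le_norm_add_norm_sub' (g s) (g l)
    linarith

set_option maxHeartbeats 1000000 in
/-- Over a fixed time, a fast Hamiltonian trajectory is a straight line up to an error `ε λ`. -/
theorem norm_backward_endpoint_sub_le {n : ℕ} {a : ℝ → V n → V n} {ρ : ℝ} (hρ : ρ < 1)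
    (hA : AssumptionA a ρ) {t₀ A R ε : ℝ} (ht₀ : 0 < t₀) (hA0 : 0 < A) (hR : 0 < R)
    (hε : 0 < ε) :
    ∃ lam₀ : ℝ, 1 ≤ lam₀ ∧ ∀ lam : ℝ, lam₀ ≤ lam → ∀ x ξ : V n, ‖x‖ ≤ R → A⁻¹ ≤ ‖ξ‖ → ‖ξ‖ ≤ A →
      ∀ X Ξ : ℝ → V n, IsHamFlow a t₀ x (lam • ξ) X Ξ →
        ‖X 0 - x + (t₀ * lam) • ξ‖ ≤ ε * lam := by
  obtain ⟨C₀, hC₀, ha₀⟩ := hA.2 0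
  obtain ⟨D, hD, ha₁⟩ := hA.2 1
  simp only [norm_iteratedFDeriv_zero, Nat.cast_zero, sub_zero] at ha₀
  simp only [norm_iteratedFDeriv_one, Nat.cast_one] at ha₁
  obtain ⟨B, hB, hB'⟩ := exists_mul_jap_le_add (n := n) hρ hC₀ one_pos
  set G : ℝ := (R + A + B) * Real.exp (2 * (1 + D) * t₀) with hG
  have hG0 : 0 < G := by positivity
  set W : ℝ := 2 * G + B with hW
  have hW0 : 0 < W := by positivity
  set δ : ℝ := min (ε / (2 * t₀)) (A⁻¹ / 4)
  have hδ0 : 0 < δ := by positivity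
  obtain ⟨B₁, hB₁, hB₁'⟩ := exists_mul_jap_le_add (n := n) (η := δ / (2 * G)) hρ hC₀ (by positivity)
  obtain ⟨M, hM⟩ := exists_mul_jap_le (n := n) (σ := ρ - 1) (C := D) (η := δ / (4 * W * t₀))
    (by linarith) (by positivity)
  set L : ℝ := (|M| + R) / (A⁻¹ / 2) with hL
  have hL0 : 0 < L := by positivity
  refine ⟨max 1 (max (2 * B₁ / δ) (2 * (D * W * L) / δ)), le_max_left _ _, ?_⟩
  intro lam hlam x ξ hx hξ hξA X Ξ hflow
  obtain ⟨hlam1, hlam2, hlam3⟩ : 1 ≤ lam ∧ 2 * B₁ ≤ δ * lam ∧ 2 * (D * W * L) ≤ δ * lam := by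
    rw [max_le_iff, max_le_iff, div_le_iff₀' hδ0, div_le_iff₀' hδ0] at hlam
    exact hlam
  have hlam0 : 0 < lam := by linarith
  obtain ⟨hX0, hΞ0, hd⟩ := hflow
  set α : ℝ → V n := fun s => a (t₀ - s) (X (t₀ - s))
  set F : ℝ → V n →L[ℝ] V n := fun s => fderiv ℝ (a (t₀ - s)) (X (t₀ - s))
  set Y : ℝ → V n := fun s => X (t₀ - s) with hYdef
  set P : ℝ → V n := fun s => Ξ (t₀ - s) with hPdef
  have hY : ∀ s, HasDerivAt Y (-(P s - α s)) s := fun s =>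
    (hd (t₀ - s)).1.comp_const_sub t₀ s
  have hP : ∀ s, HasDerivAt P (-(ContinuousLinearMap.adjoint (F s) (P s - α s))) s := fun s =>
    (hd (t₀ - s)).2.comp_const_sub t₀ s
  have hF : ∀ s, ‖F s‖ ≤ D * jap (Y s) (ρ - 1) := fun s => ha₁ _ _
  have hFD : ∀ s, ‖F s‖ ≤ D := fun s =>
    (hF s).trans (mul_le_of_le_one_right hD.le (jap_le_one (by linarith) _))
  have hα1 : ∀ s, ‖α s‖ ≤ B + ‖Y s‖ := fun s => by
    simpa using (ha₀ _ _).trans (hB' (Y s))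
  have hα2 : ∀ s, ‖α s‖ ≤ B₁ + δ / (2 * G) * ‖Y s‖ := fun s => (ha₀ _ _).trans (hB₁' (Y s))
  have hw : ∀ s, ‖P s - α s‖ ≤ ‖P s‖ + B + ‖Y s‖ := fun s =>
    (norm_sub_le _ _).trans (by linarith [hα1 s])
  have hadj : ∀ s, ‖-(ContinuousLinearMap.adjoint (F s) (P s - α s))‖ ≤ ‖F s‖ * ‖P s - α s‖ :=
    fun s => by
      rw [norm_neg]
      refine (ContinuousLinearMap.le_opNorm _ _).trans_eq ?_
      rw [LinearIsometryEquiv.norm_map]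
  have hY0 : Y 0 = x := by simp [hYdef, hX0]
  have hP0 : P 0 = lam • ξ := by simp [hPdef, hΞ0]
  have hnormξ : ‖lam • ξ‖ = lam * ‖ξ‖ := by rw [norm_smul, Real.norm_of_nonneg hlam0.le]
  have hbound : ∀ s ∈ Set.Icc 0 t₀, ‖Y s‖ ≤ G * lam ∧ ‖P s‖ ≤ G * lam := by
    intro s hs
    have h := norm_pair_le_of_linear_growth (D := D) (B := B) (δ := (R + A) * lam) hD.le hB.le
      (by positivity) hY hP (fun s => by rw [norm_neg]; exact hw s)
      (fun s => (hadj s).trans (mul_le_mul (hFD s) (hw s) (norm_nonneg _) hD.le))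
      (by rw [hY0]; nlinarith) (by rw [hP0, hnormξ]; nlinarith) hs
    have h1 : ((R + A) * lam + B) * Real.exp (2 * (1 + D) * t₀) ≤ G * lam := by
      have h2 : (R + A) * lam + B ≤ (R + A + B) * lam := by nlinarith
      rw [hG, mul_right_comm (R + A + B)]
      exact mul_le_mul_of_nonneg_right h2 (Real.exp_pos _).le
    exact ⟨h.1.trans h1, h.2.trans h1⟩
  have hwW : ∀ s ∈ Set.Icc 0 t₀, ‖P s - α s‖ ≤ W * lam := by
    intro s hs
    have h1 := hbound s hs
    have h2 := hw s
    rw [hW]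
    nlinarith
  have hαδ : ∀ s ∈ Set.Icc 0 t₀, ‖α s‖ ≤ δ * lam := by
    intro s hs
    have h1 : δ / (2 * G) * ‖Y s‖ ≤ δ / (2 * G) * (G * lam) := by
      gcongr
      exact (hbound s hs).1
    have h2 : δ / (2 * G) * (G * lam) = δ * lam / 2 := by
      field_simp
    linarith [hα2 s]
  have hvel : ∀ s ∈ Set.Icc 0 t₀, ‖-(P s - α s) + lam • ξ‖ ≤ ‖P s - lam • ξ‖ + δ * lam := by
    intro s hs
    have h1 : -(P s - α s) + lam • ξ = α s - (P s - lam • ξ) := by abel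
    rw [h1]
    linarith [norm_sub_le (α s) (P s - lam • ξ), hαδ s hs]
  have hδA : δ ≤ A⁻¹ / 4 := min_le_right _ _
  have hg := norm_le_of_deriv_small_far (Y := Y) (g := fun s => P s - lam • ξ) (v := lam • ξ)
    (T := t₀) (R := R) (M := M) (δ := δ * lam) (D := D * W * lam) (η := δ * lam / (4 * t₀))
    (l := L / lam) (κ := A⁻¹ / 2 * lam) (by positivity) (by positivity) (by positivity)
    hY (fun s => (hP s).sub_const _) (by simp [hP0]) (by rwa [hY0]) hvel
    (fun s hs => by
      refine (hadj s).trans ?_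
      rw [mul_assoc]
      exact mul_le_mul (hFD s) (hwW s hs) (norm_nonneg _) hD.le)
    (fun s hs hMs => by
      refine (hadj s).trans ((mul_le_mul ((hF s).trans (hM _ hMs)) (hwW s hs) (norm_nonneg _)
        (by positivity)).trans_eq ?_)
      field_simp)
    (by positivity)
    (by
      rw [hnormξ]
      nlinarith)
    (by
      have h1 : A⁻¹ / 2 * lam * (L / lam) = |M| + R := by
        rw [hL]
        field_simp
      rw [h1]
      linarith [le_abs_self M])
    (by
      have h1 : D * W * lam * (L / lam) = D * W * L := by field_simp
      have h2 : δ * lam / (4 * t₀) * t₀ = δ * lam / 4 := by field_simp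
      have h3 : 0 < δ * lam := by positivity
      rw [h1, h2]
      linarith)
  have hend : ‖Y t₀ - Y 0 + t₀ • lam • ξ‖ ≤ 2 * (δ * lam) * t₀ :=
    norm_sub_add_smul_le_of_deriv_add_le ht₀.le hY fun q hq => by
      have hq' := Set.Ico_subset_Icc_self hq
      linarith [hvel q hq', hg q hq']
  have hYt : Y t₀ = X 0 := by simp [hYdef]
  rw [hY0, hYt, ← mul_smul] at hend
  have h2 : δ * (2 * t₀) ≤ ε := (le_div_iff₀ (by positivity)).1 (min_le_left _ _)
  nlinarith

/-- The backward endpoint of the Hamiltonian trajectory escapes linearly: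
`|x(0; t₀, x, λξ)| ≥ c λ`; in particular
`|x(0)| ≥ λ t₀ |ξ| - |x| - (3t₀/(4a)) λ` for large `λ`. -/
theorem backward_endpoint_escape
    (n : ℕ) (hn : 2 ≤ n) (a : ℝ → V n → V n) (ρ : ℝ) (hρ : ρ < 1)
    (hA : AssumptionA a ρ)
    (t₀ : ℝ) (ht₀ : 0 < t₀) (A : ℝ) (hA1 : 1 ≤ A)
    (x₀ : V n) (ξ₀ : V n) (hξ₀ : ξ₀ ≠ 0)
    (K : Set (V n)) (hK : K ∈ nhds x₀) (hKc : IsCompact (closure K))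
    (Γ : Set (V n)) (hΓ : IsConicNbhd Γ ξ₀) :
    (∃ c : ℝ, 0 < c ∧ ∃ lam₀ : ℝ, 1 ≤ lam₀ ∧
      ∀ lam : ℝ, lam₀ ≤ lam → ∀ x ∈ K, ∀ ξ ∈ Γ, A⁻¹ ≤ ‖ξ‖ → ‖ξ‖ ≤ A →
        ∀ X Ξ : ℝ → V n, IsHamFlow a t₀ x (lam • ξ) X Ξ →
          c * lam ≤ ‖X 0‖) ∧
    (∃ lam₁ : ℝ, 1 ≤ lam₁ ∧
      ∀ lam : ℝ, lam₁ ≤ lam → ∀ x ∈ K, ∀ ξ ∈ Γ, A⁻¹ ≤ ‖ξ‖ → ‖ξ‖ ≤ A →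
        ∀ X Ξ : ℝ → V n, IsHamFlow a t₀ x (lam • ξ) X Ξ →
          lam * t₀ * ‖ξ‖ - ‖x‖ - (3 * t₀ / (4 * A)) * lam ≤ ‖X 0‖) := by
  obtain ⟨R, hR⟩ := hKc.isBounded.exists_norm_le
  have hA0 : 0 < A := by linarith
  have hε : 0 < 3 * t₀ / (4 * A) := by positivity
  obtain ⟨lam₁, h1, H⟩ := norm_backward_endpoint_sub_le hρ hA (R := |R| + 1) ht₀ hA0
    (by positivity) hε
  have key : ∀ lam : ℝ, lam₁ ≤ lam → ∀ x ∈ K, ∀ ξ ∈ Γ, A⁻¹ ≤ ‖ξ‖ → ‖ξ‖ ≤ A →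
      ∀ X Ξ : ℝ → V n, IsHamFlow a t₀ x (lam • ξ) X Ξ →
        lam * t₀ * ‖ξ‖ - ‖x‖ - (3 * t₀ / (4 * A)) * lam ≤ ‖X 0‖ := by
    intro lam hlam x hx ξ _ hξ hξA X Ξ hflow
    have h2 := H lam hlam x ξ (by linarith [hR x (subset_closure hx), le_abs_self R]) hξ hξA X Ξ
      hflow
    have h3 : ‖(t₀ * lam) • ξ‖ = lam * t₀ * ‖ξ‖ := by
      rw [norm_smul, Real.norm_of_nonneg (mul_nonneg ht₀.le (by linarith)), mul_comm t₀]
    have h4 : (t₀ * lam) • ξ = (X 0 - x + (t₀ * lam) • ξ) - X 0 + x := by abel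
    have h5 := norm_add_le ((X 0 - x + (t₀ * lam) • ξ) - X 0) x
    have h6 := norm_sub_le (X 0 - x + (t₀ * lam) • ξ) (X 0)
    rw [← h4, h3] at h5
    linarith
  refine ⟨⟨t₀ / (8 * A), by positivity, max lam₁ (|R| / (t₀ / (8 * A))),
    h1.trans (le_max_left _ _), ?_⟩, lam₁, h1, key⟩
  intro lam hlam x hx ξ hξΓ hξ hξA X Ξ hflow
  have h2 := key lam ((le_max_left _ _).trans hlam) x hx ξ hξΓ hξ hξA X Ξ hflow
  have h3 : |R| ≤ t₀ / (8 * A) * lam :=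
    (div_le_iff₀' (by positivity)).1 ((le_max_right _ _).trans hlam)
  have h4 : 0 ≤ lam := by linarith [(le_max_left _ _).trans hlam]
  have h5 : lam * t₀ * A⁻¹ ≤ lam * t₀ * ‖ξ‖ := by gcongr
  have h6 : lam * t₀ * A⁻¹ = 8 * (t₀ / (8 * A) * lam) := by field_simp
  have h7 : 3 * t₀ / (4 * A) * lam = 6 * (t₀ / (8 * A) * lam) := by
    field_simp
    ring
  linarith [hR x (subset_closure hx), le_abs_self R]

end
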